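/- For every integer n ≥ 1, the function φ ↦ F_n(φ)/φ^{n−1} is strictly increasing on (0,∞). -/

import Mathlib

open MeasureTheory Filter Set

/-- `Fn n φ = (2·(−1)^(n+1)·(n+1)!/φ)·(∑_{k=0}^{n+1} (−1)^k φ^k/k! − e^{−φ})`. -/
noncomputable def Fn (n : ℕ) (φ : ℝ) : ℝ :=
  2 * (-1 : ℝ) ^ (n + 1) * (Nat.factorial (n + 1)) / φ *
    ((∑ k ∈ Finset.range (n + 2), (-1 : ℝ) ^ k * φ ^ k / (Nat.factorial k)) - Real.exp (-φ))

/-- The Taylor remainder `(-1)^m m! (∑_{k ≤ m} (-x)^k/k! - e^{-x})`, defined recursively. -/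
noncomputable def expNegRemainder : ℕ → ℝ → ℝ
  | 0, x => 1 - Real.exp (-x)
  | m + 1, x => x ^ (m + 1) - (m + 1) * expNegRemainder m x

lemma expNegRemainder_eq_sum (m : ℕ) (x : ℝ) :
    expNegRemainder m x = (-1 : ℝ) ^ m * (Nat.factorial m) *
      ((∑ k ∈ Finset.range (m + 1), (-1 : ℝ) ^ k * x ^ k / (Nat.factorial k)) -
        Real.exp (-x)) := by
  induction m with
  | zero => simp [expNegRemainder]
  | succ m ih =>
    have hsq : (-1 : ℝ) ^ m * (-1 : ℝ) ^ m = 1 := by rw [← mul_pow]; simp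
    have hm : (Nat.factorial m : ℝ) ≠ 0 := by positivity
    have hm1 : (m : ℝ) + 1 ≠ 0 := by positivity
    rw [expNegRemainder, ih, Finset.sum_range_succ _ (m + 1), Nat.factorial_succ]
    push_cast
    field_simp
    linear_combination (-x ^ (m + 1)) * hsq

lemma expNegRemainder_zero_right (m : ℕ) : expNegRemainder m 0 = 0 := by
  induction m with
  | zero => simp [expNegRemainder]
  | succ m ih => simp [expNegRemainder, ih]

lemma hasDerivAt_expNegRemainder_zero (x : ℝ) :
    HasDerivAt (expNegRemainder 0) (Real.exp (-x)) x := by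
  have h := ((hasDerivAt_neg x).exp).const_sub 1
  simpa [expNegRemainder] using h

lemma hasDerivAt_expNegRemainder_succ (m : ℕ) (x : ℝ) :
    HasDerivAt (expNegRemainder (m + 1)) ((m + 1) * expNegRemainder m x) x := by
  induction m with
  | zero =>
    have h := (hasDerivAt_pow 1 x).fun_sub
      ((hasDerivAt_expNegRemainder_zero x).const_mul (((0 : ℕ) : ℝ) + 1))
    exact h.congr_deriv (by simp [expNegRemainder])
  | succ m ih =>
    have h := (hasDerivAt_pow (m + 2) x).fun_sub (ih.const_mul (((m + 1 : ℕ) : ℝ) + 1))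
    refine h.congr_deriv ?_
    rw [expNegRemainder, Nat.add_sub_assoc one_le_two]
    push_cast
    ring

lemma pos_of_hasDerivAt_pos {f f' : ℝ → ℝ} (hf : ∀ x, HasDerivAt f (f' x) x) (h0 : f 0 = 0)
    (hpos : ∀ x, 0 < x → 0 < f' x) {x : ℝ} (hx : 0 < x) : 0 < f x := by
  have hmono : StrictMonoOn f (Ici 0) := by
    refine strictMonoOn_of_deriv_pos (convex_Ici 0)
      (fun y _ => (hf y).continuousAt.continuousWithinAt) fun y hy => ?_
    rw [interior_Ici] at hy
    rw [(hf y).deriv]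
    exact hpos y hy
  simpa [h0] using hmono self_mem_Ici hx.le hx

lemma expNegRemainder_pos (m : ℕ) {x : ℝ} (hx : 0 < x) : 0 < expNegRemainder m x := by
  induction m generalizing x with
  | zero => simp [expNegRemainder, hx]
  | succ m ih =>
    exact pos_of_hasDerivAt_pos (hasDerivAt_expNegRemainder_succ m)
      (expNegRemainder_zero_right _) (fun y hy => mul_pos (by positivity) (ih hy)) hx

lemma expNegRemainder_succ_lt (m : ℕ) {x : ℝ} (hx : 0 < x) :
    expNegRemainder (m + 1) x < x * expNegRemainder m x := by
  rw [← sub_pos]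
  induction m generalizing x with
  | zero =>
    have h1 := Real.add_one_lt_exp hx.ne'
    have h2 := Real.exp_pos (-x)
    have h3 : Real.exp (-x) * Real.exp x = 1 := by rw [← Real.exp_add]; simp
    simp only [expNegRemainder]
    norm_num
    nlinarith
  | succ m ih =>
    refine pos_of_hasDerivAt_pos
      (f := fun y => y * expNegRemainder (m + 1) y - expNegRemainder (m + 2) y)
      (f' := fun y => (m + 1) * (y * expNegRemainder m y - expNegRemainder (m + 1) y))
      (fun y => ?_) (by simp [expNegRemainder_zero_right])
      (fun y hy => mul_pos (by positivity) (ih hy)) hx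
    refine (((hasDerivAt_id' y).fun_mul (hasDerivAt_expNegRemainder_succ m y)).fun_sub
      (hasDerivAt_expNegRemainder_succ (m + 1) y)).congr_deriv ?_
    push_cast
    ring

lemma strictMonoOn_expNegRemainder_div_pow (m : ℕ) :
    StrictMonoOn (fun x => expNegRemainder (m + 1) x / x ^ m) (Ioi 0) := by
  have hd : ∀ x ∈ Ioi (0 : ℝ), HasDerivAt (fun x => expNegRemainder (m + 1) x / x ^ m)
      (((m + 1) * expNegRemainder m x * x ^ m -
        expNegRemainder (m + 1) x * (m * x ^ (m - 1))) / (x ^ m) ^ 2) x := fun x hx =>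
    (hasDerivAt_expNegRemainder_succ m x).div (hasDerivAt_pow m x) (pow_pos hx m).ne'
  refine strictMonoOn_of_deriv_pos (convex_Ioi 0)
    (fun x hx => (hd x hx).continuousAt.continuousWithinAt) fun x hx => ?_
  rw [interior_Ioi] at hx
  rw [(hd x hx).deriv]
  have hx0 : 0 < x := hx
  refine div_pos ?_ (by positivity)
  have hR := expNegRemainder_pos m hx0
  rcases m with _ | m
  · simpa using hR
  · have hlt := sub_pos.2 (expNegRemainder_succ_lt (m + 1) hx0)
    have key : 0 < x ^ m * ((m + 1) * (x * expNegRemainder (m + 1) x -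
        expNegRemainder (m + 2) x) + x * expNegRemainder (m + 1) x) := by positivity
    refine key.trans_eq ?_
    rw [Nat.add_sub_cancel]
    push_cast
    ring

lemma Fn_div_pow_eq (n : ℕ) (hn : 1 ≤ n) (x : ℝ) :
    Fn n x / x ^ (n - 1) = 2 * (expNegRemainder (n + 1) x / x ^ n) := by
  obtain ⟨n, rfl⟩ := Nat.exists_eq_add_of_le' hn
  rw [Fn, expNegRemainder_eq_sum, Nat.add_sub_cancel, pow_succ x n]
  ring

/-- For every integer `n ≥ 1`, the function `φ ↦ Fn n φ/φ^{n−1}` is strictly increasing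
on `(0,∞)`. -/
theorem Fn_ratio_strictMono (n : ℕ) (hn : 1 ≤ n) :
    StrictMonoOn (fun φ : ℝ => Fn n φ / φ ^ (n - 1)) (Set.Ioi 0) := by
  intro x hx y hy hxy
  simp only [Fn_div_pow_eq n hn]
  exact mul_lt_mul_of_pos_left (strictMonoOn_expNegRemainder_div_pow n hx hy hxy) two_pos
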